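/- Let A be a real symmetric 2N×2N matrix, k a positive integer and λ > 0. A pair (a, b) ∈ ℝ^{2N} × ℝ^{2N} lies in the kernel of T_{k,λ}(A) if and only if the complex vector a − i·b satisfies J·A·(a − i·b) = (i·k/λ)·(a − i·b), where J·A is regarded as a complex matrix. -/

import Mathlib

open Matrix

/-- The standard symplectic `2N × 2N` matrix `J = [[0, I],[−I, 0]]`. -/
noncomputable def symJ (N : ℕ) : Matrix (Fin N ⊕ Fin N) (Fin N ⊕ Fin N) ℝ :=
  Matrix.fromBlocks 0 1 (-1) 0

/-- The `4N × 4N` block matrix `T_{k,λ}(A) = [[−(λ/k)A, −J],[J, −(λ/k)A]]`. -/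
noncomputable def Tmat (N : ℕ) (k : ℕ) (lam : ℝ)
    (A : Matrix (Fin N ⊕ Fin N) (Fin N ⊕ Fin N) ℝ) :
    Matrix ((Fin N ⊕ Fin N) ⊕ (Fin N ⊕ Fin N)) ((Fin N ⊕ Fin N) ⊕ (Fin N ⊕ Fin N)) ℝ :=
  Matrix.fromBlocks ((-(lam / (k : ℝ))) • A) (-(symJ N)) (symJ N) ((-(lam / (k : ℝ))) • A)

/-- The standard symplectic matrix squares to `-1`. -/
theorem symJ_mul_self (N : ℕ) : symJ N * symJ N = -1 := by
  rw [symJ, Matrix.fromBlocks_multiply, ← Matrix.fromBlocks_one, Matrix.fromBlocks_neg]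
  simp

theorem symJ_mulVec_symJ_mulVec (N : ℕ) (v : Fin N ⊕ Fin N → ℝ) :
    symJ N *ᵥ (symJ N *ᵥ v) = -v := by
  rw [Matrix.mulVec_mulVec, symJ_mul_self, Matrix.neg_mulVec, Matrix.one_mulVec]

theorem symJ_mulVec_eq_iff (N : ℕ) (v w : Fin N ⊕ Fin N → ℝ) :
    symJ N *ᵥ v = w ↔ v = -(symJ N *ᵥ w) := by
  constructor
  · rintro rfl
    rw [symJ_mulVec_symJ_mulVec, neg_neg]
  · rintro rfl
    rw [Matrix.mulVec_neg, symJ_mulVec_symJ_mulVec, neg_neg]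

/-- The kernel of `T_{k,λ}(A)` in terms of the real matrix `J·A`. -/
theorem Tmat_mulVec_eq_zero_iff (N : ℕ) {k : ℕ} (hk : k ≠ 0) {lam : ℝ} (hlam : lam ≠ 0)
    (A : Matrix (Fin N ⊕ Fin N) (Fin N ⊕ Fin N) ℝ) (a b : Fin N ⊕ Fin N → ℝ) :
    Tmat N k lam A *ᵥ Sum.elim a b = 0 ↔
      (symJ N * A) *ᵥ a = ((k : ℝ) / lam) • b ∧ (symJ N * A) *ᵥ b = -(((k : ℝ) / lam) • a) := by
  have hc : lam / (k : ℝ) ≠ 0 := div_ne_zero hlam (Nat.cast_ne_zero.mpr hk)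
  have hinv : (k : ℝ) / lam = (lam / (k : ℝ))⁻¹ := (inv_div _ _).symm
  rw [Tmat, Matrix.fromBlocks_mulVec, Sum.elim_comp_inl, Sum.elim_comp_inr,
    ← Sum.elim_zero_zero, Sum.elim_eq_iff, ← Matrix.mulVec_mulVec, ← Matrix.mulVec_mulVec,
    symJ_mulVec_eq_iff, symJ_mulVec_eq_iff, hinv]
  generalize lam / (k : ℝ) = c at hc
  simp only [Matrix.smul_mulVec, Matrix.neg_mulVec, Matrix.mulVec_neg, Matrix.mulVec_smul,
    neg_neg, neg_smul]
  refine and_congr ?_ ?_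
  · rw [← smul_neg c⁻¹, eq_inv_smul_iff₀ hc, ← neg_add, neg_eq_zero, add_eq_zero_iff_eq_neg]
  · rw [eq_inv_smul_iff₀ hc, ← sub_eq_add_neg, sub_eq_zero, eq_comm]

theorem map_ofReal_mulVec_sub_I_mul {m n : Type*} [Fintype n] (M : Matrix m n ℝ) (a b : n → ℝ)
    (i : m) :
    (M.map (fun x : ℝ => (x : ℂ)) *ᵥ fun j => (a j : ℂ) - Complex.I * (b j : ℂ)) i =
      ((M *ᵥ a) i : ℂ) - Complex.I * ((M *ᵥ b) i : ℂ) := by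
  simp only [Matrix.mulVec, dotProduct, Matrix.map_apply, Complex.ofReal_sum,
    Complex.ofReal_mul, Finset.mul_sum, ← Finset.sum_sub_distrib]
  exact Finset.sum_congr rfl fun j _ => by ring

/-- `(a, b)` lies in the kernel of `T_{k,λ}(A)` iff the complex vector `a − i·b` satisfies
`J·A·(a − i·b) = (i·k/λ)·(a − i·b)`. -/
theorem stmt2 (N : ℕ) (k : ℕ) (hk : 0 < k) (lam : ℝ) (hlam : 0 < lam)
    (A : Matrix (Fin N ⊕ Fin N) (Fin N ⊕ Fin N) ℝ) (hA : A.IsSymm)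
    (a b : (Fin N ⊕ Fin N) → ℝ) :
    (Tmat N k lam A).mulVec (Sum.elim a b) = 0 ↔
      ((symJ N * A).map (fun x : ℝ => (x : ℂ))).mulVec (fun i => (a i : ℂ) - Complex.I * (b i : ℂ))
        = (Complex.I * ((k : ℂ) / (lam : ℂ))) • (fun i => (a i : ℂ) - Complex.I * (b i : ℂ)) := by
  rw [Tmat_mulVec_eq_zero_iff N hk.ne' hlam.ne']
  simp only [funext_iff, map_ofReal_mulVec_sub_I_mul, ← forall_and]
  refine forall_congr' fun i => ?_
  rw [← Complex.ofReal_natCast, ← Complex.ofReal_div, Complex.ext_iff]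
  simp [-Complex.ofReal_div, neg_eq_iff_eq_neg]
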